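/- Let L be the entire continuation of the Cantor Dirichlet series (assumed to exist). For A > 0 and T ≥ 3 define the exceptional set E_A(T) = { t ∈ [T, 2T] : |L(1/2 + it)| > (log t)^A }. Then for every A > 0 there is a constant K(A) such that for all T ≥ 3, the Lebesgue measure of E_A(T) is at most K(A)·T/(log T)^{4A−3}. In particular, for every A > 3/4 the bound |L(1/2 + it)| ≤ (log t)^A holds for all t ∈ [T, 2T] outside a set of measure o(T). -/

import Mathlib

open Complex Real

/-- `r(n) = ∏_{j=1}^∞ cos(3n/(4·3^j))`: the real cosine product giving the
Fourier coefficients of the ternary Cantor measure rescaled to `[0.5, 2.0]`. -/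
noncomputable def cantorR (n : ℕ) : ℝ :=
  ∏' j : ℕ, Real.cos (3 * n / (4 * 3 ^ (j + 1)))

/-- `â(n) = e^{i(5/4)n} r(n)`: the Fourier coefficients of the rescaled ternary
Cantor measure. -/
noncomputable def cantorA (n : ℕ) : ℂ :=
  Complex.exp (Complex.I * (5 / 4) * n) * (cantorR n : ℂ)

/-- The Cantor Dirichlet series `∑_{n≥1} â(n) n^{-s}` (as a `tsum`). -/
noncomputable def cantorSeries (s : ℂ) : ℂ :=
  ∑' n : ℕ, cantorA (n + 1) * ((n + 1 : ℕ) : ℂ) ^ (-s)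

/-- `d = log 2 / log 3`, the Hausdorff dimension of the ternary Cantor set. -/
noncomputable def cantorDim : ℝ := Real.log 2 / Real.log 3

open MeasureTheory

lemma geo_bound (N : ℕ) (y : ℝ) (h0 : 0 < y) (h1 : y ≤ π) :
    ‖∑ n ∈ Finset.range N, Complex.exp (Complex.I * y * (n + 1))‖ ≤ π / y := by
  have hs : 2 * y / π ≤ ‖Complex.exp (Complex.I * y) - 1‖ := by
    rw [Complex.norm_exp_I_mul_ofReal_sub_one]
    have h := Real.mul_le_sin (x := y / 2) (by positivity) (by linarith)
    have h2 : (0:ℝ) ≤ 2 / π * (y / 2) := by positivity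
    rw [Real.norm_of_nonneg (by linarith)]
    have : 2 * y / π = 2 * (2 / π * (y / 2)) := by ring
    linarith
  have hpos : 0 < 2 * y / π := by positivity
  set z := Complex.exp (Complex.I * y) with hz
  have hz1 : ‖z‖ = 1 := by rw [hz, mul_comm]; exact Complex.norm_exp_ofReal_mul_I y
  have hne : z ≠ 1 := by
    intro h
    rw [h] at hs; simp at hs; linarith
  have hsum : ∑ n ∈ Finset.range N, Complex.exp (Complex.I * y * (n + 1))
      = z * ((z ^ N - 1) / (z - 1)) := by
    rw [← geom_sum_eq hne, Finset.mul_sum]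
    refine Finset.sum_congr rfl fun n _ => ?_
    rw [hz, ← Complex.exp_nat_mul, ← Complex.exp_add]
    congr 1; ring
  rw [hsum, norm_mul, norm_div, hz1, one_mul]
  have hnum : ‖z ^ N - 1‖ ≤ 2 := by
    refine (norm_sub_le _ _).trans ?_
    rw [norm_pow, hz1]; norm_num
  calc ‖z ^ N - 1‖ / ‖z - 1‖ ≤ 2 / (2 * y / π) := by gcongr
    _ = π / y := by field_simp

lemma prod_cos_bound {ι : Type*} (N : ℕ) (B : ℝ) (θ : ι → ℝ) (hθ : ∀ i, 0 ≤ θ i)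
    (s : Finset ι) : ∀ y : ℝ, (∀ y' : ℝ, |y' - y| ≤ ∑ i ∈ s, θ i →
      ‖∑ n ∈ Finset.range N, Complex.exp (Complex.I * y' * (n + 1))‖ ≤ B) →
    ‖∑ n ∈ Finset.range N, Complex.exp (Complex.I * y * (n + 1)) *
      ((∏ i ∈ s, Real.cos ((n + 1) * θ i) : ℝ) : ℂ)‖ ≤ B := by
  classical
  induction s using Finset.induction_on with
  | empty =>
    intro y h
    simpa using h y (by simp)
  | insert a s ha ih =>
    intro y h
    have h1 := ih (y + θ a) (fun y' hy' => h y' (by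
      rw [Finset.sum_insert ha]
      have := hθ a
      rw [abs_le] at hy' ⊢
      constructor <;> linarith [hy'.1, hy'.2]))
    have h2 := ih (y - θ a) (fun y' hy' => h y' (by
      rw [Finset.sum_insert ha]
      have := hθ a
      rw [abs_le] at hy' ⊢
      constructor <;> linarith [hy'.1, hy'.2]))
    have key : ∑ n ∈ Finset.range N, Complex.exp (Complex.I * y * (n + 1)) *
      ((∏ i ∈ insert a s, Real.cos ((n + 1) * θ i) : ℝ) : ℂ) =
      (1 / 2 : ℂ) * (∑ n ∈ Finset.range N, Complex.exp (Complex.I * ((y + θ a : ℝ) : ℂ) * (n + 1)) *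
      ((∏ i ∈ s, Real.cos ((n + 1) * θ i) : ℝ) : ℂ)) + (1 / 2 : ℂ) *
      (∑ n ∈ Finset.range N, Complex.exp (Complex.I * ((y - θ a : ℝ) : ℂ) * (n + 1)) *
      ((∏ i ∈ s, Real.cos ((n + 1) * θ i) : ℝ) : ℂ)) := by
      rw [Finset.mul_sum, Finset.mul_sum, ← Finset.sum_add_distrib]
      refine Finset.sum_congr rfl fun n _ => ?_
      rw [Finset.prod_insert ha, Complex.ofReal_mul, Complex.ofReal_cos, Complex.cos]
      have e1 : Complex.exp (Complex.I * ((y + θ a : ℝ) : ℂ) * (n + 1)) =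
        Complex.exp (Complex.I * y * (n + 1)) * Complex.exp ((((n + 1) * θ a : ℝ) : ℂ) * Complex.I) := by
        rw [← Complex.exp_add]; congr 1; push_cast; ring
      have e2 : Complex.exp (Complex.I * ((y - θ a : ℝ) : ℂ) * (n + 1)) =
        Complex.exp (Complex.I * y * (n + 1)) * Complex.exp (-(((n + 1) * θ a : ℝ) : ℂ) * Complex.I) := by
        rw [← Complex.exp_add]; congr 1; push_cast; ring
      rw [e1, e2]; ring
    rw [key]
    refine (norm_add_le _ _).trans ?_
    rw [norm_mul, norm_mul]
    have hh : ‖(1 / 2 : ℂ)‖ = 1 / 2 := by norm_num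
    rw [hh]
    linarith

noncomputable def th (k : ℕ) : ℝ := 1 / (4 * 3 ^ k)

lemma th_pos (k : ℕ) : 0 < th k := by unfold th; positivity

lemma th_sum (j m : ℕ) : ∑ k ∈ Finset.range m, th (j + k) ≤ 3 / 2 * th j - 3 / 2 * th (j + m) := by
  induction m with
  | zero => simp
  | succ m ih =>
    rw [Finset.sum_range_succ]
    have : th (j + (m + 1)) = th (j + m) / 3 := by
      unfold th; rw [← add_assoc, pow_succ]; field_simp
    rw [this]; linarith

lemma cantorR_tendsto (n : ℕ) : Filter.Tendsto
    (fun K => ∏ k ∈ Finset.range K, Real.cos (n * th k)) Filter.atTop (nhds (cantorR n)) := by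
  have hm : Multipliable (fun j : ℕ => Real.cos (3 * n / (4 * 3 ^ (j + 1)))) := by
    have : Summable (fun j : ℕ => Real.cos (3 * n / (4 * 3 ^ (j + 1))) - 1) := by
      refine Summable.of_norm_bounded (g := fun j : ℕ => (n:ℝ)^2 * (1/9) ^ j) ?_ ?_
      · exact (summable_geometric_of_lt_one (by norm_num) (by norm_num)).mul_left _
      · intro j
        have h1 := Real.one_sub_sq_div_two_le_cos (x := 3 * n / (4 * 3 ^ (j + 1)))
        have h2 := Real.cos_le_one (3 * n / (4 * 3 ^ (j + 1)))
        rw [Real.norm_of_nonpos (by linarith)]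
        have : (3 * (n:ℝ) / (4 * 3 ^ (j + 1)))^2 = n^2 * (1/9)^j / 16 := by
          have : ((1:ℝ)/9)^j = (1 / 3^j)^2 := by rw [← one_div_pow, ← pow_mul, mul_comm, pow_mul]; norm_num
          rw [this, pow_succ]; field_simp; ring
        have hp : (0:ℝ) ≤ n^2 * (1/9)^j := by positivity
        linarith
    have := Real.multipliable_one_add_of_summable this
    simpa using this
  have h := hm.hasProd.tendsto_prod_nat
  unfold cantorR
  refine h.congr fun K => Finset.prod_congr rfl fun k _ => ?_
  congr 1; unfold th; rw [pow_succ]; field_simp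

lemma cantorR_sq_le (n K : ℕ) : cantorR n ^ 2 ≤ ∏ k ∈ Finset.range K, Real.cos (n * th k) ^ 2 := by
  have h := (cantorR_tendsto n).pow 2
  refine le_of_tendsto h ?_
  filter_upwards [Filter.eventually_ge_atTop K] with M hM
  rw [← Finset.prod_pow]
  refine Finset.prod_le_prod_of_subset_of_le_one (Finset.range_mono hM) ?_ ?_
  · intro i _; positivity
  · intro i _ _; exact Real.cos_sq_le_one _

lemma cantorA_sum_bound (N : ℕ) : ‖∑ n ∈ Finset.range N, cantorA (n + 1)‖ ≤ 4 := by
  have h : Filter.Tendsto (fun K => ∑ n ∈ Finset.range N,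
      Complex.exp (Complex.I * (5 / 4 : ℝ) * (n + 1)) *
      ((∏ k ∈ Finset.range K, Real.cos ((n + 1) * th k) : ℝ) : ℂ)) Filter.atTop
      (nhds (∑ n ∈ Finset.range N, cantorA (n + 1))) := by
    refine tendsto_finsetSum _ fun n _ => ?_
    unfold cantorA
    have := (Complex.continuous_ofReal.tendsto _).comp (cantorR_tendsto (n + 1))
    have := this.const_mul (Complex.exp (Complex.I * (5 / 4) * ((n + 1 : ℕ) : ℂ)))
    refine this.congr fun K => ?_
    simp
  refine le_of_tendsto h.norm (Filter.Eventually.of_forall fun K => ?_)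
  refine prod_cos_bound N 4 th (fun k => (th_pos k).le) _ _ fun y hy => ?_
  have h1 := th_sum 0 K
  simp only [zero_add] at h1
  have h2 := th_pos K
  have h3 : th 0 = 1 / 4 := by simp [th]
  rw [abs_le] at hy
  have hpi := Real.pi_gt_three
  have hpi2 := Real.pi_lt_d2
  refine (geo_bound N y (by linarith) (by linarith)).trans ?_
  rw [div_le_iff₀ (by linarith)]
  linarith

lemma sq_sum_aux (N m : ℕ) : ∀ j : ℕ,
    ∑ n ∈ Finset.range N, ∏ k ∈ Finset.range m, Real.cos ((n + 1) * th (j + k)) ^ 2 ≤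
      N / 2 ^ m + 4 * π * 3 ^ j * ((3 / 2) ^ m - 1) := by
  induction m with
  | zero => intro j; simp
  | succ m ih =>
    intro j
    have hb : |∑ n ∈ Finset.range N, Real.cos (2 * ((n + 1) * th j)) *
        ∏ k ∈ Finset.range m, Real.cos ((n + 1) * th (j + 1 + k)) ^ 2| ≤ 4 * π * 3 ^ j := by
      have := prod_cos_bound N (4 * π * 3 ^ j) (fun p : ℕ × Fin 2 => th (j + 1 + p.1))
        (fun p => (th_pos _).le) (Finset.range m ×ˢ Finset.univ) (2 * th j) (by
          intro y hy
          rw [Finset.sum_product] at hy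
          simp only [Finset.sum_const, Finset.card_univ, Fintype.card_fin, ← Finset.smul_sum] at hy
          have h1 := th_sum (j + 1) m
          have h2 := th_pos (j + 1 + m)
          have h3 : th (j + 1) = th j / 3 := by unfold th; rw [pow_succ]; field_simp
          have h4 := th_pos j
          have h5 : th j ≤ 1 / 4 := by
            unfold th
            apply one_div_le_one_div_of_le (by norm_num)
            have : (1:ℝ) ≤ 3 ^ j := one_le_pow₀ (by norm_num)
            linarith
          have hpi := Real.pi_gt_three
          simp only [nsmul_eq_mul, Nat.cast_ofNat] at hy
          rw [abs_le] at hy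
          have hy1 : th j ≤ y := by linarith
          refine (geo_bound N y (by linarith) (by linarith)).trans ?_
          have : 4 * π * 3 ^ j = π / th j := by unfold th; field_simp
          rw [this]
          gcongr)
      refine le_trans ?_ this
      refine le_trans (le_of_eq ?_) (Complex.abs_re_le_norm _)
      congr 1
      rw [Complex.re_sum]
      refine Finset.sum_congr rfl fun n _ => ?_
      rw [Complex.re_mul_ofReal, Finset.prod_product]
      congr 1
      · have : Complex.I * ((2 * th j : ℝ) : ℂ) * (n + 1) = ((2 * ((n + 1) * th j) : ℝ) : ℂ) * Complex.I := by
          push_cast; ring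
        rw [this, Complex.exp_ofReal_mul_I_re]
      · simp
    have hrec : ∑ n ∈ Finset.range N, ∏ k ∈ Finset.range (m + 1), Real.cos ((n + 1) * th (j + k)) ^ 2
      = 1 / 2 * (∑ n ∈ Finset.range N, ∏ k ∈ Finset.range m, Real.cos ((n + 1) * th (j + 1 + k)) ^ 2)
        + 1 / 2 * (∑ n ∈ Finset.range N, Real.cos (2 * ((n + 1) * th j)) *
        ∏ k ∈ Finset.range m, Real.cos ((n + 1) * th (j + 1 + k)) ^ 2) := by
      rw [Finset.mul_sum, Finset.mul_sum, ← Finset.sum_add_distrib]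
      refine Finset.sum_congr rfl fun n _ => ?_
      rw [Finset.prod_range_succ', add_zero, Real.cos_sq]
      have hk : ∀ k, j + (k + 1) = j + 1 + k := fun k => by ring
      rw [Finset.prod_congr rfl (fun k _ => by rw [hk k])]
      ring
    rw [hrec]
    have h1 := ih (j + 1)
    have h2 := (abs_le.mp hb).2
    have : (N:ℝ) / 2 ^ (m + 1) + 4 * π * 3 ^ j * ((3 / 2) ^ (m + 1) - 1)
      = 1 / 2 * (N / 2 ^ m + 4 * π * 3 ^ (j + 1) * ((3 / 2) ^ m - 1)) + 1 / 2 * (4 * π * 3 ^ j) := by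
      rw [pow_succ, pow_succ, pow_succ]; field_simp; ring
    rw [this]; linarith

lemma sq_sum_bound (N : ℕ) :
    ∑ n ∈ Finset.range N, cantorR (n + 1) ^ 2 ≤ 16 * (N : ℝ) ^ (2 / 5 : ℝ) := by
  rcases Nat.eq_zero_or_pos N with rfl | hN
  · simp
  set K := Nat.log 3 N
  have h1 : 3 ^ K ≤ N := Nat.pow_log_le_self 3 hN.ne'
  have h2 : N < 3 ^ (K + 1) := Nat.lt_pow_succ_log_self (by norm_num) N
  have h1' : (3:ℝ) ^ K ≤ N := by exact_mod_cast h1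
  have h2' : (N:ℝ) ≤ 3 ^ (K + 1) := by exact_mod_cast h2.le
  have h3 : ∑ n ∈ Finset.range N, cantorR (n + 1) ^ 2 ≤ N / 2 ^ K + 4 * π * ((3 / 2) ^ K - 1) := by
    have := sq_sum_aux N K 0
    simp only [zero_add, pow_zero, mul_one] at this
    refine le_trans (Finset.sum_le_sum fun n _ => ?_) this
    have := cantorR_sq_le (n + 1) K
    push_cast at this
    exact this
  have h4 : (N:ℝ) / 2 ^ K ≤ 3 * (3 / 2) ^ K := by
    rw [div_pow, ← mul_div_assoc]
    gcongr
    rw [pow_succ] at h2'; linarith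
  have h5 : ((3:ℝ) / 2) ^ K ≤ (N:ℝ) ^ (2 / 5 : ℝ) := by
    have : (3:ℝ) / 2 ≤ 3 ^ (2 / 5 : ℝ) := by
      rw [Real.le_rpow_iff_log_le (by norm_num) (by norm_num)]
      have : Real.log ((3 / 2) ^ 5) ≤ Real.log (3 ^ 2) := Real.log_le_log (by norm_num) (by norm_num)
      rw [Real.log_pow, Real.log_pow] at this
      push_cast at this
      linarith
    calc ((3:ℝ) / 2) ^ K ≤ (3 ^ (2 / 5 : ℝ)) ^ K := by gcongr
      _ = (3 ^ K) ^ (2 / 5 : ℝ) := by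
        rw [← Real.rpow_natCast, ← Real.rpow_natCast, ← Real.rpow_mul (by norm_num), ← Real.rpow_mul (by norm_num), mul_comm]
      _ ≤ _ := by gcongr
  have hpi2 := Real.pi_lt_d2
  have h6 : (0:ℝ) < (3 / 2) ^ K := by positivity
  nlinarith [Real.pi_pos]

lemma cantorR_abs_le (n : ℕ) : |cantorR n| ≤ 1 := by
  have := cantorR_sq_le n 0
  simp at this
  exact this

lemma cantorA_norm (n : ℕ) : ‖cantorA n‖ = |cantorR n| := by
  unfold cantorA
  rw [norm_mul, Complex.norm_real, Real.norm_eq_abs]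
  have : Complex.I * (5 / 4) * (n : ℂ) = ((5 / 4 * n : ℝ) : ℂ) * Complex.I := by push_cast; ring
  rw [this, Complex.norm_exp_ofReal_mul_I, one_mul]

lemma cpow_diff (n : ℕ) (s : ℂ) (hs : 0 < s.re) :
    ‖((n + 1 : ℕ) : ℂ) ^ (-s) - ((n + 2 : ℕ) : ℂ) ^ (-s)‖ ≤ ‖s‖ * ((n + 1 : ℕ) : ℝ) ^ (-s.re - 1) := by
  have hs0 : s ≠ 0 := by rintro rfl; simp at hs
  have h := Convex.norm_image_sub_le_of_norm_hasDerivWithin_le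
    (f := fun u : ℝ => (u : ℂ) ^ (-s)) (f' := fun u : ℝ => (-s) * (u : ℂ) ^ (-s - 1))
    (s := Set.Ici ((n + 1 : ℕ) : ℝ)) (C := ‖s‖ * ((n + 1 : ℕ) : ℝ) ^ (-s.re - 1))
    (x := ((n + 2 : ℕ) : ℝ)) (y := ((n + 1 : ℕ) : ℝ))
    (by
      intro x hx
      have hx0 : 0 < x := lt_of_lt_of_le (by positivity) hx
      exact (hasDerivAt_ofReal_cpow_const hx0.ne' (neg_ne_zero.mpr hs0)).hasDerivWithinAt)
    (by
      intro x hx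
      have hx0 : 0 < x := lt_of_lt_of_le (by positivity) hx
      rw [norm_mul, norm_neg, Complex.norm_cpow_eq_rpow_re_of_pos hx0]
      simp only [Complex.sub_re, Complex.neg_re, Complex.one_re]
      gcongr ?_ * ?_
      exact Real.rpow_le_rpow_of_nonpos (by positivity) hx (by linarith))
    (convex_Ici _) (by simp) (by simp)
  have h12 : |(1:ℝ) - 2| = 1 := by norm_num
  simpa [h12] using h

lemma inv_sqrt_tel (n : ℕ) (hn : 1 ≤ n) :
    ((n + 1 : ℕ) : ℝ) ^ (-(1 / 2) - 1 : ℝ) ≤ 2 * (1 / √(n : ℝ) - 1 / √((n + 1 : ℕ) : ℝ)) := by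
  have hn' : (1:ℝ) ≤ n := by exact_mod_cast hn
  have h1 : ((n + 1 : ℕ) : ℝ) ^ (-(1 / 2) - 1 : ℝ) = 1 / (√((n + 1 : ℕ) : ℝ)) ^ 3 := by
    rw [Real.sqrt_eq_rpow, ← Real.rpow_natCast, ← Real.rpow_mul (by positivity),
      one_div (_ ^ _), ← Real.rpow_neg (by positivity)]
    norm_num
  rw [h1]
  set a := √(n : ℝ) with ha
  set b := √((n + 1 : ℕ) : ℝ) with hb
  have ha0 : 0 < a := Real.sqrt_pos.mpr (by linarith)
  have hab : a ≤ b := Real.sqrt_le_sqrt (by push_cast; linarith)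
  have ha2 : a ^ 2 = n := Real.sq_sqrt (by positivity)
  have hb2 : b ^ 2 = n + 1 := by rw [hb, Real.sq_sqrt (by positivity)]; push_cast; ring
  have hb0 : 0 < b := by linarith
  have : 1 / a - 1 / b = 1 / (a * b * (a + b)) := by
    have : (b - a) * (a + b) = 1 := by nlinarith
    field_simp
    linarith
  rw [this, mul_one_div, div_le_div_iff₀ (by positivity) (by positivity)]
  nlinarith [mul_nonneg ha0.le hb0.le, mul_nonneg (mul_nonneg ha0.le hb0.le) (sub_nonneg.mpr hab), mul_nonneg (mul_nonneg hb0.le hb0.le) (sub_nonneg.mpr hab)]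

lemma approx_L (L : ℂ → ℂ) (hL : Differentiable ℂ L)
    (hLeq : ∀ s : ℂ, 1 < s.re → L s = cantorSeries s) (N : ℕ) (hN : 1 ≤ N) (s : ℂ)
    (hs : s.re = 1 / 2) :
    ‖L s - ∑ n ∈ Finset.range N, cantorA (n + 1) * ((n + 1 : ℕ) : ℂ) ^ (-s)‖ ≤
      16 * ‖s‖ / √(N : ℝ) := by
  set S : ℕ → ℂ := fun m => ∑ n ∈ Finset.range m, cantorA (n + 1) with hS
  have hSb : ∀ m, ‖S m - S N‖ ≤ 8 := fun m => by
    refine (norm_sub_le _ _).trans ?_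
    linarith [cantorA_sum_bound m, cantorA_sum_bound N]
  set g : ℕ → ℂ → ℂ := fun n w => ((n + 1 : ℕ) : ℂ) ^ (-w) with hg
  set F : ℕ → ℂ → ℂ := fun i w => (S (N + i + 1) - S N) * (g (N + i) w - g (N + i + 1) w) with hF
  have hFb : ∀ i w, 0 < w.re → ‖F i w‖ ≤ 8 * (‖w‖ * ((N + i + 1 : ℕ) : ℝ) ^ (-w.re - 1)) := by
    intro i w hw
    simp only [hF]
    rw [norm_mul]
    exact mul_le_mul (hSb _) (cpow_diff (N + i) w hw) (norm_nonneg _) (by norm_num)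
  have abel : ∀ (w : ℂ) (M : ℕ), ∑ i ∈ Finset.range M, cantorA (N + i + 1) * g (N + i) w =
      (S (N + M) - S N) * g (N + M) w + ∑ i ∈ Finset.range M, F i w := by
    intro w M
    induction M with
    | zero => simp
    | succ M ih =>
      rw [Finset.sum_range_succ, Finset.sum_range_succ, ih]
      have : S (N + M + 1) = S (N + M) + cantorA (N + M + 1) := Finset.sum_range_succ _ _
      simp only [hF, ← add_assoc]
      rw [this]; ring
  set R : ℝ := ‖s‖ + 3 with hR
  set U : Set ℂ := {w : ℂ | 1 / 4 < w.re} ∩ Metric.ball 0 R with hU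
  have hUo : IsOpen U := (isOpen_lt continuous_const Complex.continuous_re).inter Metric.isOpen_ball
  have hUc : IsPreconnected U :=
    ((convex_halfSpace_re_gt _).inter (convex_ball _ _)).isPreconnected
  have hsum : Summable (fun i : ℕ => 8 * (R * ((N + i + 1 : ℕ) : ℝ) ^ (-(5 / 4) : ℝ))) := by
    have h1 : Summable (fun i : ℕ => (i : ℝ) ^ (-(5 / 4) : ℝ)) :=
      Real.summable_nat_rpow.mpr (by norm_num)
    have h2 := (summable_nat_add_iff (N + 1)).mpr h1
    refine ((h2.mul_left R).mul_left 8).congr fun i => ?_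
    rw [show i + (N + 1) = N + i + 1 by ring]
  have hFU : ∀ i w, w ∈ U → ‖F i w‖ ≤ 8 * (R * ((N + i + 1 : ℕ) : ℝ) ^ (-(5 / 4) : ℝ)) := by
    intro i w hw
    have hw1 : 1 / 4 < w.re := hw.1
    have hw2 : ‖w‖ < R := by simpa using hw.2
    refine (hFb i w (by linarith)).trans ?_
    have : ((N + i + 1 : ℕ) : ℝ) ^ (-w.re - 1) ≤ ((N + i + 1 : ℕ) : ℝ) ^ (-(5 / 4) : ℝ) :=
      Real.rpow_le_rpow_of_exponent_le (by norm_cast; omega) (by linarith)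
    gcongr
  have hgd : ∀ n, Differentiable ℂ (g n) := fun n => by
    intro w
    exact (differentiableAt_id.neg).const_cpow (Or.inl (by exact_mod_cast Nat.succ_ne_zero n))
  have hG : DifferentiableOn ℂ (fun w => ∑' i, F i w) U :=
    differentiableOn_tsum_of_summable_norm hsum
      (fun i => (((hgd _).sub (hgd _)).const_mul _).differentiableOn) hUo hFU
  have hH : Differentiable ℂ (fun w => L w - ∑ n ∈ Finset.range N, cantorA (n + 1) * g n w) :=
    hL.sub (Differentiable.fun_sum fun n _ => (hgd n).const_mul _)
  have h2U : (2 : ℂ) ∈ U := by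
    refine ⟨by simp; norm_num, ?_⟩
    simp [hR]; linarith [norm_nonneg s]
  have hsU : s ∈ U := ⟨by simp [hs]; norm_num, by simp [hR]⟩
  have hloc : (fun w => L w - ∑ n ∈ Finset.range N, cantorA (n + 1) * g n w) =ᶠ[nhds 2]
      (fun w => ∑' i, F i w) := by
    have hV : {w : ℂ | 1 < w.re} ∈ nhds (2 : ℂ) :=
      (isOpen_lt continuous_const Complex.continuous_re).mem_nhds (by simp)
    filter_upwards [hV, hUo.mem_nhds h2U] with w hw hwU
    have hw : 1 < w.re := hw
    rw [hLeq w hw]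
    have hsm : Summable (fun n : ℕ => cantorA (n + 1) * g n w) := by
      have h1 : Summable (fun n : ℕ => (n : ℝ) ^ (-w.re)) :=
        Real.summable_nat_rpow.mpr (by linarith)
      refine Summable.of_norm_bounded ((summable_nat_add_iff 1).mpr h1) fun n => ?_
      rw [norm_mul, cantorA_norm]
      simp only [hg]
      rw [Complex.norm_natCast_cpow_of_pos (Nat.succ_pos n), Complex.neg_re]
      exact mul_le_of_le_one_left (by positivity) (cantorR_abs_le _)
    have hse : cantorSeries w = ∑' n, cantorA (n + 1) * g n w := rfl
    rw [hse, ← hsm.sum_add_tsum_nat_add N, add_sub_cancel_left]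
    have hT1 := ((summable_nat_add_iff N).mpr hsm).hasSum.tendsto_sum_nat
    have hT2 := (Summable.of_norm_bounded hsum (fun i => hFU i w hwU)).hasSum.tendsto_sum_nat
    have hT3 : Filter.Tendsto (fun M => (S (N + M) - S N) * g (N + M) w) Filter.atTop (nhds 0) := by
      refine squeeze_zero_norm (a := fun M : ℕ => 8 * ((M + (N + 1) : ℕ) : ℝ) ^ (-w.re)) ?_ ?_
      · intro M
        rw [norm_mul]
        simp only [hg]
        rw [Complex.norm_natCast_cpow_of_pos (Nat.succ_pos _), Complex.neg_re,
          show M + (N + 1) = N + M + 1 by ring]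
        gcongr
        exact hSb _
      · have := (tendsto_rpow_neg_atTop (show 0 < w.re by linarith)).comp
          (tendsto_natCast_atTop_atTop (R := ℝ))
        have := (this.comp (Filter.tendsto_add_atTop_nat (N + 1))).const_mul 8
        simpa using this
    refine tendsto_nhds_unique hT1 ?_
    have := hT3.add hT2
    rw [zero_add] at this
    refine this.congr fun M => ?_
    rw [← abel]
    refine Finset.sum_congr rfl fun i _ => ?_
    rw [add_comm i N]
  have heq := (hH.differentiableOn.analyticOnNhd hUo).eqOn_of_preconnected_of_eventuallyEq
    (hG.analyticOnNhd hUo) hUc h2U hloc hsU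
  simp only at heq
  simp only [hg] at heq ⊢
  rw [heq]
  have htel : HasSum (fun i : ℕ => 1 / √((N + i : ℕ) : ℝ) - 1 / √((N + i + 1 : ℕ) : ℝ)) (1 / √(N : ℝ)) := by
    rw [hasSum_iff_tendsto_nat_of_nonneg]
    · have : Filter.Tendsto (fun M : ℕ => 1 / √((N : ℕ) : ℝ) - 1 / √((M + N : ℕ) : ℝ))
          Filter.atTop (nhds (1 / √(N : ℝ) - 0)) := by
        refine tendsto_const_nhds.sub ?_
        have := (Real.tendsto_sqrt_atTop.comp (tendsto_natCast_atTop_atTop (R := ℝ))).inv_tendsto_atTop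
        have := this.comp (Filter.tendsto_add_atTop_nat N)
        refine this.congr fun M => ?_
        simp
      rw [sub_zero] at this
      refine this.congr fun M => ?_
      have := Finset.sum_range_sub' (fun i : ℕ => 1 / √((N + i : ℕ) : ℝ)) M
      rw [add_comm M N]
      exact this.symm
    · intro i
      rw [sub_nonneg]
      apply one_div_le_one_div_of_le
      · apply Real.sqrt_pos.mpr; norm_cast; omega
      · apply Real.sqrt_le_sqrt; norm_cast; omega
  have := tsum_of_norm_bounded (htel.mul_left (16 * ‖s‖)) (f := fun i => F i s) (fun i => by
    refine (hFb i s (by rw [hs]; norm_num)).trans ?_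
    rw [hs]
    have := inv_sqrt_tel (N + i) (by omega)
    have h0 := norm_nonneg s
    calc 8 * (‖s‖ * ((N + i + 1 : ℕ) : ℝ) ^ (-(1 / 2) - 1 : ℝ)) ≤
      8 * (‖s‖ * (2 * (1 / √((N + i : ℕ) : ℝ) - 1 / √((N + i + 1 : ℕ) : ℝ)))) := by gcongr
      _ = _ := by ring)
  refine this.trans (le_of_eq ?_)
  ring

lemma mv_general (s : Finset ℕ) (d : ℕ → ℂ) (l : ℕ → ℝ) (hl : ∀ m n, m ≠ n → l m ≠ l n)
    (T : ℝ) (hT : 0 ≤ T) :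
    ∫ t in T..(2 * T), ‖∑ n ∈ s, d n * Complex.exp (-(Complex.I * t * l n))‖ ^ 2 ≤
      ∑ m ∈ s, ∑ n ∈ s, ‖d m‖ * ‖d n‖ * (if m = n then T else 2 / |l m - l n|) := by
  have hexp : ∀ t : ℝ, ((‖∑ n ∈ s, d n * Complex.exp (-(Complex.I * t * l n))‖ ^ 2 : ℝ) : ℂ) =
      ∑ m ∈ s, ∑ n ∈ s, (d m * (starRingEnd ℂ) (d n)) *
        Complex.exp (Complex.I * ((l n - l m : ℝ) : ℂ) * t) := by
    intro t
    rw [Complex.ofReal_pow, ← Complex.mul_conj', map_sum, Finset.sum_mul_sum]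
    refine Finset.sum_congr rfl fun m _ => Finset.sum_congr rfl fun n _ => ?_
    rw [map_mul, ← Complex.exp_conj]
    have : Complex.exp (Complex.I * ((l n - l m : ℝ) : ℂ) * t) =
      Complex.exp (-(Complex.I * t * l m)) *
      Complex.exp ((starRingEnd ℂ) (-(Complex.I * t * l n))) := by
      rw [← Complex.exp_add]
      congr 1
      simp only [map_neg, map_mul, Complex.conj_I, Complex.conj_ofReal]
      push_cast; ring
    rw [this]; ring
  have h1 : ((∫ t in T..(2 * T), ‖∑ n ∈ s, d n * Complex.exp (-(Complex.I * t * l n))‖ ^ 2 : ℝ) : ℂ) =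
      ∑ m ∈ s, ∑ n ∈ s, (d m * (starRingEnd ℂ) (d n)) *
        ∫ t in T..(2 * T), Complex.exp (Complex.I * ((l n - l m : ℝ) : ℂ) * t) := by
    rw [← intervalIntegral.integral_ofReal]
    simp_rw [hexp]
    rw [intervalIntegral.integral_finsetSum]
    · refine Finset.sum_congr rfl fun m _ => ?_
      rw [intervalIntegral.integral_finsetSum]
      · refine Finset.sum_congr rfl fun n _ => ?_
        rw [intervalIntegral.integral_const_mul]
      · intro n _
        apply Continuous.intervalIntegrable
        fun_prop
    · intro m _
      apply Continuous.intervalIntegrable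
      fun_prop
  have h2 : (∫ t in T..(2 * T), ‖∑ n ∈ s, d n * Complex.exp (-(Complex.I * t * l n))‖ ^ 2) ≤
      ‖((∫ t in T..(2 * T), ‖∑ n ∈ s, d n * Complex.exp (-(Complex.I * t * l n))‖ ^ 2 : ℝ) : ℂ)‖ := by
    rw [Complex.norm_real]; exact Real.le_norm_self _
  refine h2.trans ?_
  rw [h1]
  refine (norm_sum_le _ _).trans (Finset.sum_le_sum fun m _ => ?_)
  refine (norm_sum_le _ _).trans (Finset.sum_le_sum fun n _ => ?_)
  rw [norm_mul, norm_mul, RCLike.norm_conj]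
  gcongr
  split_ifs with h
  · subst h
    simp
    rw [show 2 * (T : ℂ) - T = T by ring, Complex.norm_real, Real.norm_of_nonneg hT]
  · have hne : l n - l m ≠ 0 := sub_ne_zero.mpr (hl n m (Ne.symm h))
    have hne' : Complex.I * ((l n - l m : ℝ) : ℂ) ≠ 0 :=
      mul_ne_zero Complex.I_ne_zero (by exact_mod_cast hne)
    rw [integral_exp_mul_complex hne', norm_div, norm_mul, Complex.norm_I, one_mul, Complex.norm_real,
      Real.norm_eq_abs, abs_sub_comm (l n)]
    gcongr
    refine (norm_sub_le _ _).trans ?_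
    have : ∀ x : ℝ, ‖Complex.exp (Complex.I * ((l n - l m : ℝ) : ℂ) * x)‖ = 1 := by
      intro x
      rw [show Complex.I * ((l n - l m : ℝ) : ℂ) * x = (((l n - l m) * x : ℝ) : ℂ) * Complex.I by push_cast; ring]
      exact Complex.norm_exp_ofReal_mul_I _
    rw [this, this]; norm_num

lemma log_kernel_aux (x y : ℝ) (hx : 0 < x) (hxy : x < y) :
    1 / (√x * √y * |Real.log x - Real.log y|) ≤ 1 / (√x * √y) + 1 / |x - y| := by
  have hy : 0 < y := hx.trans hxy
  have h1 : (y - x) / y ≤ |Real.log x - Real.log y| := by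
    have := Real.one_sub_inv_le_log_of_pos (show 0 < y / x by positivity)
    rw [Real.log_div hy.ne' hx.ne', inv_div] at this
    rw [abs_sub_comm]
    refine le_trans (le_of_eq ?_) (this.trans (le_abs_self _))
    field_simp
  have hd : 0 < y - x := by linarith
  rw [abs_sub_comm x y, abs_of_pos hd]
  have h2 : 1 / (√x * √y * |Real.log x - Real.log y|) ≤ 1 / (√x * √y * ((y - x) / y)) := by
    gcongr
  refine h2.trans ?_
  have hsx : 0 < √x := Real.sqrt_pos.mpr hx
  have hsy : 0 < √y := Real.sqrt_pos.mpr hy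
  have e : 1 / (√x * √y * ((y - x) / y)) = 1 / (√x * √y) + x / (√x * √y) * (1 / (y - x)) := by
    field_simp; ring
  rw [e]
  have h3 : x / (√x * √y) ≤ 1 := by
    rw [div_le_one (by positivity)]
    calc x = √x * √x := (Real.mul_self_sqrt hx.le).symm
      _ ≤ √x * √y := by gcongr
  have h4 : 0 < 1 / (y - x) := by positivity
  nlinarith

lemma log_kernel (x y : ℝ) (hx : 0 < x) (hy : 0 < y) (hxy : x ≠ y) :
    1 / (√x * √y * |Real.log x - Real.log y|) ≤ 1 / (√x * √y) + 1 / |x - y| := by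
  rcases lt_or_gt_of_ne hxy with h | h
  · exact log_kernel_aux x y hx h
  · have := log_kernel_aux y x hy h
    rwa [abs_sub_comm (Real.log y), abs_sub_comm y, mul_comm √y] at this

lemma harm_sum (N : ℕ) : ∑ i ∈ Finset.range N, 1 / ((i : ℝ) + 1) ≤ 1 + Real.log N := by
  have := harmonic_le_one_add_log N
  unfold harmonic at this
  push_cast at this
  simpa using this

lemma harm_row (N m : ℕ) (hm : m < N) :
    ∑ n ∈ Finset.range N, (if m = n then 0 else 1 / |((m : ℝ) + 1) - ((n : ℝ) + 1)|) ≤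
      2 * (1 + Real.log N) := by
  have hh : ∑ i ∈ Finset.range N, ((i : ℕ) : ℝ)⁻¹ ≤ 1 + Real.log N := by
    refine le_trans ?_ (harm_sum N)
    have h1 : ∑ i ∈ Finset.range (N + 1), ((i : ℕ) : ℝ)⁻¹ = ∑ i ∈ Finset.range N, 1 / ((i : ℝ) + 1) := by
      rw [Finset.sum_range_succ']; simp
    rw [← h1, Finset.sum_range_succ]
    have : (0:ℝ) ≤ ((N : ℕ) : ℝ)⁻¹ := by positivity
    linarith
  have mono : ∀ M, M ≤ N → ∑ i ∈ Finset.range M, ((i : ℕ) : ℝ)⁻¹ ≤ 1 + Real.log N := fun M hM =>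
    (Finset.sum_le_sum_of_subset_of_nonneg (Finset.range_mono hM) (fun i _ _ => by positivity)).trans hh
  have hterm : ∀ n : ℕ, (if m = n then 0 else 1 / |((m : ℝ) + 1) - ((n : ℝ) + 1)|) =
      ((m - n : ℕ) : ℝ)⁻¹ + ((n - m : ℕ) : ℝ)⁻¹ := by
    intro n
    rcases lt_trichotomy m n with h | h | h
    · rw [if_neg h.ne, Nat.sub_eq_zero_of_le h.le, Nat.cast_sub h.le]
      have : (m:ℝ) < n := by exact_mod_cast h
      rw [add_sub_add_right_eq_sub, abs_of_neg (by linarith)]; simp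
    · subst h; simp
    · rw [if_neg h.ne', Nat.sub_eq_zero_of_le h.le, Nat.cast_sub h.le]
      have : (n:ℝ) < m := by exact_mod_cast h
      rw [add_sub_add_right_eq_sub, abs_of_pos (by linarith)]; simp
  rw [Finset.sum_congr rfl (fun n _ => hterm n), Finset.sum_add_distrib]
  have hA : ∑ n ∈ Finset.range N, ((m - n : ℕ) : ℝ)⁻¹ ≤ 1 + Real.log N := by
    obtain ⟨j, rfl⟩ := Nat.exists_eq_add_of_lt hm
    rw [show m + j + 1 = (m + 1) + j by ring, Finset.sum_range_add]
    have h1 : ∑ x ∈ Finset.range j, ((m - (m + 1 + x) : ℕ) : ℝ)⁻¹ = 0 :=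
      Finset.sum_eq_zero fun x _ => by rw [Nat.sub_eq_zero_of_le (by omega)]; simp
    have h2 := Finset.sum_range_reflect (fun i : ℕ => ((i : ℕ) : ℝ)⁻¹) (m + 1)
    simp only [Nat.add_sub_cancel] at h2
    rw [h1, add_zero, h2]
    have := mono (m + 1) (by omega)
    rwa [show m + j + 1 = (m + 1) + j by ring] at this
  have hB : ∑ n ∈ Finset.range N, ((n - m : ℕ) : ℝ)⁻¹ ≤ 1 + Real.log N := by
    obtain ⟨j, rfl⟩ := Nat.exists_eq_add_of_le hm.le
    rw [Finset.sum_range_add]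
    have h1 : ∑ x ∈ Finset.range m, ((x - m : ℕ) : ℝ)⁻¹ = 0 :=
      Finset.sum_eq_zero fun x hx => by
        rw [Nat.sub_eq_zero_of_le (Finset.mem_range.mp hx).le]; simp
    simp only [Nat.add_sub_cancel_left]
    rw [h1, zero_add]
    exact mono j (by omega)
  linarith

lemma mv_dirichlet (N : ℕ) (s : Finset ℕ) (hs : s ⊆ Finset.range N) (c : ℕ → ℂ) (T : ℝ)
    (hT : 0 ≤ T) :
    ∫ t in T..(2 * T), ‖∑ n ∈ s, c n * ((n + 1 : ℕ) : ℂ) ^ (-(1 / 2 + t * Complex.I) : ℂ)‖ ^ 2 ≤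
      T * ∑ n ∈ s, ‖c n‖ ^ 2 / ((n : ℝ) + 1) + 6 * (1 + Real.log N) * ∑ n ∈ s, ‖c n‖ ^ 2 := by
  set l : ℕ → ℝ := fun n => Real.log ((n : ℝ) + 1) with hl
  set q : ℕ → ℝ := fun n => √((n : ℝ) + 1) with hq
  have hq0 : ∀ n, 0 < q n := fun n => Real.sqrt_pos.mpr (by positivity)
  have hq2 : ∀ n, q n * q n = (n : ℝ) + 1 := fun n => Real.mul_self_sqrt (by positivity)
  have hlinj : ∀ m n, m ≠ n → l m ≠ l n := by
    intro m n hmn h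
    have := Real.log_injOn_pos (show ((m:ℝ) + 1) ∈ Set.Ioi 0 by simp; positivity)
      (show ((n:ℝ) + 1) ∈ Set.Ioi 0 by simp; positivity) h
    apply hmn
    have : (m:ℝ) = n := by linarith
    exact_mod_cast this
  have hrw : ∀ t : ℝ, ∑ n ∈ s, c n * ((n + 1 : ℕ) : ℂ) ^ (-(1 / 2 + t * Complex.I) : ℂ) =
      ∑ n ∈ s, (c n / (q n : ℂ)) * Complex.exp (-(Complex.I * t * l n)) := by
    intro t
    refine Finset.sum_congr rfl fun n _ => ?_
    have hn0 : ((n + 1 : ℕ) : ℂ) ≠ 0 := by exact_mod_cast Nat.succ_ne_zero n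
    have hlog : Complex.log ((n + 1 : ℕ) : ℂ) = (l n : ℂ) := by
      rw [← Complex.natCast_log]
      simp [hl]
    have hqe : (q n : ℂ)⁻¹ = Complex.exp (-(1 / 2) * (l n : ℂ)) := by
      have : (q n)⁻¹ = Real.exp (-(1 / 2) * l n) := by
        simp only [hq, hl]
        rw [Real.sqrt_eq_rpow, Real.rpow_def_of_pos (by positivity), ← Real.exp_neg]
        congr 1; ring
      rw [← Complex.ofReal_inv, this]; push_cast; rfl
    rw [Complex.cpow_def_of_ne_zero hn0, hlog, div_eq_mul_inv (c n), hqe, mul_assoc, ← Complex.exp_add]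
    congr 2; ring
  simp_rw [hrw]
  refine (mv_general s _ l hlinj T hT).trans ?_
  have hnd : ∀ n, ‖c n / (q n : ℂ)‖ = ‖c n‖ / q n := fun n => by
    rw [norm_div, Complex.norm_real, Real.norm_of_nonneg (hq0 n).le]
  simp_rw [hnd]
  set k : ℕ → ℕ → ℝ := fun m n => if m = n then 0 else 1 / |((m : ℝ) + 1) - ((n : ℝ) + 1)| with hk
  have hk0 : ∀ m n, 0 ≤ k m n := fun m n => by
    simp only [hk]; split_ifs <;> positivity
  have hksymm : ∀ m n, k m n = k n m := fun m n => by
    simp only [hk, eq_comm (a := m), abs_sub_comm ((m:ℝ) + 1)]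
  have hterm : ∀ m n, ‖c m‖ / q m * (‖c n‖ / q n) * (if m = n then T else 2 / |l m - l n|) ≤
      (if m = n then T * (‖c m‖ ^ 2 / ((m : ℝ) + 1)) else 0) +
      (2 * ((‖c m‖ / q m) * (‖c n‖ / q n)) + (‖c m‖ ^ 2 * k m n + ‖c n‖ ^ 2 * k n m)) := by
    intro m n
    have hm := hq0 m
    have hn := hq0 n
    by_cases h : m = n
    · subst h
      simp only [if_true, hk, mul_zero, add_zero]
      have : ‖c m‖ / q m * (‖c m‖ / q m) * T = T * (‖c m‖ ^ 2 / ((m : ℝ) + 1)) := by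
        rw [← hq2]; field_simp
      rw [this]
      have : 0 ≤ 2 * (‖c m‖ / q m * (‖c m‖ / q m)) := by positivity
      linarith
    · rw [if_neg h, if_neg h, zero_add, ← hksymm m n]
      have hne : (m:ℝ) + 1 ≠ (n:ℝ) + 1 := by
        intro h'; apply h
        have : (m:ℝ) = n := by linarith
        exact_mod_cast this
      have hker := log_kernel ((m:ℝ) + 1) ((n:ℝ) + 1) (by positivity) (by positivity) hne
      have hkmn : k m n = 1 / |((m : ℝ) + 1) - ((n : ℝ) + 1)| := by simp only [hk, if_neg h]
      rw [← hkmn] at hker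
      have e : ‖c m‖ / q m * (‖c n‖ / q n) * (2 / |l m - l n|) =
        2 * (‖c m‖ * ‖c n‖) * (1 / (q m * q n * |l m - l n|)) := by
        rw [div_mul_div_comm, div_mul_div_comm, mul_one_div]; ring
      rw [e]
      have e2 : 2 * (‖c m‖ / q m * (‖c n‖ / q n)) = 2 * (‖c m‖ * ‖c n‖) * (1 / (q m * q n)) := by
        rw [div_mul_div_comm, mul_assoc, mul_one_div]
      rw [e2]
      have h3 : 2 * (‖c m‖ * ‖c n‖) * (1 / (q m * q n * |l m - l n|)) ≤
        2 * (‖c m‖ * ‖c n‖) * (1 / (q m * q n) + k m n) := by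
        gcongr
      have h4 : 2 * (‖c m‖ * ‖c n‖) * k m n ≤ (‖c m‖ ^ 2 + ‖c n‖ ^ 2) * k m n := by
        have := hk0 m n
        gcongr
        nlinarith [sq_nonneg (‖c m‖ - ‖c n‖)]
      linarith
  refine (Finset.sum_le_sum fun m _ => Finset.sum_le_sum fun n _ => hterm m n).trans ?_
  simp only [Finset.sum_add_distrib]
  have hd : ∑ m ∈ s, ∑ n ∈ s, (if m = n then T * (‖c m‖ ^ 2 / ((m : ℝ) + 1)) else 0) =
      T * ∑ n ∈ s, ‖c n‖ ^ 2 / ((n : ℝ) + 1) := by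
    rw [Finset.mul_sum]
    refine Finset.sum_congr rfl fun m hm => ?_
    rw [Finset.sum_ite_eq, if_pos hm]
  have hcs : ∑ m ∈ s, ∑ n ∈ s, 2 * (‖c m‖ / q m * (‖c n‖ / q n)) ≤
      2 * ((1 + Real.log N) * ∑ n ∈ s, ‖c n‖ ^ 2) := by
    simp_rw [← Finset.mul_sum]
    rw [← Finset.sum_mul]
    refine mul_le_mul_of_nonneg_left ?_ (by norm_num)
    have h1 := Finset.sum_mul_sq_le_sq_mul_sq s (fun n => ‖c n‖) (fun n => 1 / q n)
    have h2 : ∑ n ∈ s, (1 / q n) ^ 2 ≤ 1 + Real.log N := by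
      refine le_trans ?_ (harm_sum N)
      refine le_trans (Finset.sum_le_sum_of_subset_of_nonneg hs (fun i _ _ => by positivity)) ?_
      refine Finset.sum_le_sum fun i _ => ?_
      rw [← hq2, one_div_pow, sq]
    have h0 : 0 ≤ ∑ n ∈ s, ‖c n‖ ^ 2 := Finset.sum_nonneg fun _ _ => by positivity
    simp only [mul_one_div] at h1
    rw [sq] at h1
    refine h1.trans ?_
    rw [mul_comm]
    gcongr
  have hr1 : ∑ m ∈ s, ∑ n ∈ s, ‖c m‖ ^ 2 * k m n ≤ 2 * (1 + Real.log N) * ∑ n ∈ s, ‖c n‖ ^ 2 := by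
    rw [Finset.mul_sum]
    refine Finset.sum_le_sum fun m hm => ?_
    rw [← Finset.mul_sum, mul_comm]
    gcongr
    refine le_trans ?_ (harm_row N m (Finset.mem_range.mp (hs hm)))
    exact Finset.sum_le_sum_of_subset_of_nonneg hs (fun i _ _ => hk0 m i)
  have hr2 : ∑ m ∈ s, ∑ n ∈ s, ‖c n‖ ^ 2 * k n m ≤ 2 * (1 + Real.log N) * ∑ n ∈ s, ‖c n‖ ^ 2 := by
    rw [Finset.sum_comm]; exact hr1
  rw [hd]
  linarith

lemma exists_C0 : ∃ C : ℝ, 0 < C ∧ ∀ s : Finset ℕ,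
    ∑ n ∈ s, cantorR (n + 1) ^ 2 / √((n : ℝ) + 1) ≤ C := by
  have hO : (fun n : ℕ => ∑ k ∈ Finset.Icc 1 n, cantorR k ^ 2) =O[Filter.atTop]
      fun n : ℕ => (n : ℝ) ^ (2 / 5 : ℝ) := by
    refine Asymptotics.IsBigO.of_bound 16 (Filter.Eventually.of_forall fun n => ?_)
    rw [Real.norm_of_nonneg (Finset.sum_nonneg fun _ _ => by positivity),
      Real.norm_of_nonneg (by positivity)]
    refine le_trans (le_of_eq ?_) (sq_sum_bound n)
    rw [Finset.range_eq_Ico, Finset.sum_Ico_add' (fun k => cantorR k ^ 2) 0 n 1]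
    rfl
  have h := LSeriesSummable_of_sum_norm_bigO_and_nonneg (s := (1 / 2 : ℂ)) hO
    (fun n => by positivity) (by norm_num) (by norm_num)
  have h2 := ((summable_nat_add_iff 1).mpr h.norm)
  have h3 : Summable (fun n : ℕ => cantorR (n + 1) ^ 2 / √((n : ℝ) + 1)) := by
    refine h2.congr fun n => ?_
    rw [LSeries.term_of_ne_zero (Nat.succ_ne_zero n), norm_div, Complex.norm_natCast_cpow_of_pos (Nat.succ_pos n),
      Complex.norm_real, Real.norm_of_nonneg (by positivity), Real.sqrt_eq_rpow]
    norm_num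
  refine ⟨(∑' n : ℕ, cantorR (n + 1) ^ 2 / √((n : ℝ) + 1)) + 1, ?_, fun s => ?_⟩
  · have : 0 ≤ ∑' n : ℕ, cantorR (n + 1) ^ 2 / √((n : ℝ) + 1) := tsum_nonneg fun _ => by positivity
    linarith
  · have := h3.sum_le_tsum s (fun _ _ => by positivity)
    linarith

lemma sum_inv_sqrt (M : ℕ) : ∑ n ∈ Finset.range M, 1 / √((n : ℝ) + 1) ≤ 2 * √(M : ℝ) := by
  induction M with
  | zero => simp
  | succ M ih =>
    rw [Finset.sum_range_succ]
    push_cast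
    set a := √(M : ℝ)
    set b := √((M : ℝ) + 1)
    have ha : 0 ≤ a := Real.sqrt_nonneg _
    have hb : 0 < b := Real.sqrt_pos.mpr (by positivity)
    have ha2 : a ^ 2 = M := Real.sq_sqrt (by positivity)
    have hb2 : b ^ 2 = M + 1 := Real.sq_sqrt (by positivity)
    have : 1 / b ≤ 2 * (b - a) := by
      rw [div_le_iff₀ hb]
      nlinarith [sq_nonneg (b - a)]
    linarith

lemma meas_large (L : ℂ → ℂ) (hL : Differentiable ℂ L)
    (hLeq : ∀ s : ℂ, 1 < s.re → L s = cantorSeries s) (C : ℝ) (hC : 0 < C)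
    (hC0 : ∀ s : Finset ℕ, ∑ n ∈ s, cantorR (n + 1) ^ 2 / √((n : ℝ) + 1) ≤ C)
    (T V : ℝ) (hT : 3 ≤ T) (hV : 192 ≤ V)
    (hVT : Real.log T * V ^ 2 ≤ T ^ (1 / 5 : ℝ)) :
    (volume {t : ℝ | t ∈ Set.Icc T (2 * T) ∧ V < ‖L (1 / 2 + t * Complex.I)‖}).toReal ≤
      4 * (32 * C ^ 2 + 768) * T / V ^ 4 := by
  have hT0 : 0 < T := by linarith
  have hV0 : 0 < V := by linarith
  have hlogT : 1 ≤ Real.log T := by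
    rw [Real.le_log_iff_exp_le hT0]
    linarith [Real.exp_one_lt_d9]
  set N : ℕ := ⌈T ^ 2⌉₊ with hN
  have hN1 : T ^ 2 ≤ N := Nat.le_ceil _
  have hN2 : (N : ℝ) ≤ 2 * T ^ 2 := by
    have := Nat.ceil_lt_add_one (show 0 ≤ T ^ 2 by positivity)
    nlinarith
  have hNpos : (0:ℝ) < N := by nlinarith
  have hNge : 1 ≤ N := by exact_mod_cast hNpos
  set X : ℝ := V ^ 2 / (32 * C) with hX
  have hX0 : 0 < X := by positivity
  set s1 := (Finset.range N).filter (fun n : ℕ => (n : ℝ) + 1 ≤ X ^ 2) with hs1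
  set s2 := (Finset.range N).filter (fun n : ℕ => ¬ ((n : ℝ) + 1 ≤ X ^ 2)) with hs2
  set P1 : ℝ → ℂ := fun t => ∑ n ∈ s1, cantorA (n + 1) * ((n + 1 : ℕ) : ℂ) ^ (-(1 / 2 + t * Complex.I) : ℂ) with hP1
  set P2 : ℝ → ℂ := fun t => ∑ n ∈ s2, cantorA (n + 1) * ((n + 1 : ℕ) : ℂ) ^ (-(1 / 2 + t * Complex.I) : ℂ) with hP2
  have hP1b : ∀ t, ‖P1 t‖ ≤ V / 4 := by
    intro t
    have h1 : ‖P1 t‖ ≤ ∑ n ∈ s1, |cantorR (n + 1)| / √((n : ℝ) + 1) := by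
      refine (norm_sum_le _ _).trans (Finset.sum_le_sum fun n _ => ?_)
      rw [norm_mul, cantorA_norm, Complex.norm_natCast_cpow_of_pos (Nat.succ_pos n), div_eq_mul_inv |cantorR (n + 1)|,
        Real.sqrt_eq_rpow, ← Real.rpow_neg (by positivity)]
      simp
    have h2 : (∑ n ∈ s1, |cantorR (n + 1)| / √((n : ℝ) + 1)) ^ 2 ≤
        (∑ n ∈ s1, cantorR (n + 1) ^ 2 / √((n : ℝ) + 1)) * ∑ n ∈ s1, 1 / √((n : ℝ) + 1) := by
      refine Finset.sum_sq_le_sum_mul_sum_of_sq_eq_mul s1 (fun n _ => by positivity)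
        (fun n _ => by positivity) (fun n _ => ?_)
      rw [div_pow, sq_abs, sq (√_)]
      field_simp
    have h3 : ∑ n ∈ s1, 1 / √((n : ℝ) + 1) ≤ 2 * X := by
      have hsub : s1 ⊆ Finset.range ⌊X ^ 2⌋₊ := by
        intro n hn
        rw [hs1, Finset.mem_filter] at hn
        rw [Finset.mem_range]
        have : n + 1 ≤ ⌊X ^ 2⌋₊ := Nat.le_floor (by push_cast; exact hn.2)
        omega
      refine (Finset.sum_le_sum_of_subset_of_nonneg hsub (fun _ _ _ => by positivity)).trans ?_
      refine (sum_inv_sqrt _).trans ?_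
      gcongr
      rw [Real.sqrt_le_left hX0.le]
      exact Nat.floor_le (by positivity)
    have h4 : (∑ n ∈ s1, |cantorR (n + 1)| / √((n : ℝ) + 1)) ^ 2 ≤ (V / 4) ^ 2 := by
      refine h2.trans ?_
      calc _ ≤ C * (2 * X) := by
            refine mul_le_mul (hC0 s1) h3 (Finset.sum_nonneg fun _ _ => by positivity) hC.le
        _ = (V / 4) ^ 2 := by rw [hX]; field_simp; ring
    exact h1.trans (le_of_sq_le_sq h4 (by positivity))
  have hE : ∀ t ∈ Set.Icc T (2 * T), ‖L (1 / 2 + t * Complex.I) - (P1 t + P2 t)‖ ≤ V / 4 := by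
    intro t ht
    have h1 := approx_L L hL hLeq N hNge (1 / 2 + t * Complex.I) (by simp)
    have h2 : P1 t + P2 t = ∑ n ∈ Finset.range N,
        cantorA (n + 1) * ((n + 1 : ℕ) : ℂ) ^ (-(1 / 2 + t * Complex.I) : ℂ) :=
      Finset.sum_filter_add_sum_filter_not _ _ _
    rw [h2]
    refine h1.trans ?_
    have h3 : ‖(1 / 2 + t * Complex.I : ℂ)‖ ≤ 3 * T := by
      refine (norm_add_le _ _).trans ?_
      rw [norm_mul, Complex.norm_I, Complex.norm_real, Real.norm_of_nonneg (by linarith [ht.1])]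
      have : ‖(1 / 2 : ℂ)‖ = 1 / 2 := by norm_num
      rw [this]
      linarith [ht.2]
    have h4 : T ≤ √(N : ℝ) := Real.le_sqrt_of_sq_le hN1
    rw [div_le_iff₀ (by linarith)]
    nlinarith
  have hint : ∫ t in T..(2 * T), ‖P2 t‖ ^ 2 ≤ (32 * C ^ 2 + 768) * T / V ^ 2 := by
    refine (mv_dirichlet N s2 (Finset.filter_subset _ _) (fun n => cantorA (n + 1)) T hT0.le).trans ?_
    simp only [cantorA_norm, sq_abs]
    have h1 : ∑ n ∈ s2, cantorR (n + 1) ^ 2 / ((n : ℝ) + 1) ≤ 32 * C ^ 2 / V ^ 2 := by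
      have : ∀ n ∈ s2, cantorR (n + 1) ^ 2 / ((n : ℝ) + 1) ≤
          1 / X * (cantorR (n + 1) ^ 2 / √((n : ℝ) + 1)) := by
        intro n hn
        rw [hs2, Finset.mem_filter, not_le] at hn
        have hsq : √((n : ℝ) + 1) * √((n : ℝ) + 1) = (n : ℝ) + 1 := Real.mul_self_sqrt (by positivity)
        have hXs : X ≤ √((n : ℝ) + 1) := Real.le_sqrt_of_sq_le hn.2.le
        rw [div_mul_div_comm, one_mul]
        gcongr
        calc X * √((n : ℝ) + 1) ≤ √((n : ℝ) + 1) * √((n : ℝ) + 1) := by gcongr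
          _ = _ := hsq
      refine (Finset.sum_le_sum this).trans ?_
      rw [← Finset.mul_sum]
      calc 1 / X * _ ≤ 1 / X * C := by gcongr; exact hC0 s2
        _ = _ := by rw [hX]; field_simp
    have h2 : ∑ n ∈ s2, cantorR (n + 1) ^ 2 ≤ 32 * T ^ (4 / 5 : ℝ) := by
      refine (Finset.sum_le_sum_of_subset_of_nonneg (Finset.filter_subset _ _)
        (fun _ _ _ => by positivity)).trans ?_
      refine (sq_sum_bound N).trans ?_
      have : (N : ℝ) ^ (2 / 5 : ℝ) ≤ 2 * T ^ (4 / 5 : ℝ) := by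
        calc (N : ℝ) ^ (2 / 5 : ℝ) ≤ (2 * T ^ 2) ^ (2 / 5 : ℝ) := by gcongr
          _ = 2 ^ (2 / 5 : ℝ) * T ^ (4 / 5 : ℝ) := by
            rw [Real.mul_rpow (by norm_num) (by positivity), ← Real.rpow_natCast T 2, ← Real.rpow_mul hT0.le]
            norm_num
          _ ≤ 2 ^ (1 : ℝ) * T ^ (4 / 5 : ℝ) := by
            gcongr <;> norm_num
          _ = _ := by rw [Real.rpow_one]
      linarith
    have h3 : Real.log N ≤ 1 + 2 * Real.log T := by
      calc Real.log N ≤ Real.log (2 * T ^ 2) := Real.log_le_log hNpos hN2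
        _ = Real.log 2 + 2 * Real.log T := by
          rw [Real.log_mul (by norm_num) (by positivity), Real.log_pow]; push_cast; ring
        _ ≤ _ := by linarith [Real.log_two_lt_d9]
    have h4 : 6 * (1 + Real.log N) * ∑ n ∈ s2, cantorR (n + 1) ^ 2 ≤ 768 * T / V ^ 2 := by
      have h5 : (0:ℝ) ≤ ∑ n ∈ s2, cantorR (n + 1) ^ 2 := Finset.sum_nonneg fun _ _ => by positivity
      have h6 : T ^ (4 / 5 : ℝ) * T ^ (1 / 5 : ℝ) = T := by
        rw [← Real.rpow_add hT0]; norm_num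
      have h7 : 0 < T ^ (4 / 5 : ℝ) := by positivity
      calc 6 * (1 + Real.log N) * ∑ n ∈ s2, cantorR (n + 1) ^ 2
          ≤ 6 * (4 * Real.log T) * (32 * T ^ (4 / 5 : ℝ)) := by
            refine mul_le_mul (by linarith) h2 h5 (by linarith)
        _ ≤ 768 * T / V ^ 2 := by
            rw [le_div_iff₀ (by positivity)]
            nlinarith [mul_le_mul_of_nonneg_left hVT h7.le]
    calc _ ≤ T * (32 * C ^ 2 / V ^ 2) + 768 * T / V ^ 2 := by gcongr
      _ = _ := by ring
  have hcont : Continuous P2 := by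
    refine continuous_finsetSum _ fun n _ => ?_
    refine continuous_const.mul ?_
    refine Continuous.const_cpow (by fun_prop) (Or.inl ?_)
    exact_mod_cast Nat.succ_ne_zero n
  have hcheb := mul_meas_ge_le_integral_of_nonneg (μ := volume.restrict (Set.Icc T (2 * T)))
    (f := fun t => ‖P2 t‖ ^ 2) (Filter.Eventually.of_forall fun t => by positivity)
    ((hcont.norm.pow 2).continuousOn.integrableOn_compact isCompact_Icc) ((V / 2) ^ 2)
  rw [integral_Icc_eq_integral_Ioc, ← intervalIntegral.integral_of_le (by linarith)] at hcheb
  have hsubm : (volume {t : ℝ | t ∈ Set.Icc T (2 * T) ∧ V < ‖L (1 / 2 + t * Complex.I)‖}).toReal ≤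
      (volume.restrict (Set.Icc T (2 * T))).real {t | (V / 2) ^ 2 ≤ ‖P2 t‖ ^ 2} := by
    rw [Measure.real, Measure.restrict_apply' measurableSet_Icc]
    refine ENNReal.toReal_mono ?_ (measure_mono ?_)
    · refine ne_top_of_le_ne_top ?_ (measure_mono Set.inter_subset_right)
      simp
    · rintro t ⟨ht, hv⟩
      refine ⟨?_, ht⟩
      have h1 := hE t ht
      have h2 := hP1b t
      have h3 : ‖L (1 / 2 + t * Complex.I)‖ ≤ ‖L (1 / 2 + t * Complex.I) - (P1 t + P2 t)‖ + (‖P1 t‖ + ‖P2 t‖) := by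
        calc _ = ‖(L (1 / 2 + t * Complex.I) - (P1 t + P2 t)) + (P1 t + P2 t)‖ := by rw [sub_add_cancel]
          _ ≤ _ := (norm_add_le _ _).trans (by gcongr; exact norm_add_le _ _)
      have h4 : V / 2 ≤ ‖P2 t‖ := by linarith
      show (V / 2) ^ 2 ≤ ‖P2 t‖ ^ 2
      gcongr
  refine hsubm.trans ?_
  have hfin := hcheb.trans hint
  rw [le_div_iff₀ (by positivity)] at hfin ⊢
  nlinarith

lemma part_one (L : ℂ → ℂ) (hL : Differentiable ℂ L)
    (hLeq : ∀ s : ℂ, 1 < s.re → L s = cantorSeries s) (A : ℝ) (hA : 0 < A) :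
    ∃ K : ℝ, ∀ T : ℝ, 3 ≤ T →
      (volume {t : ℝ | t ∈ Set.Icc T (2 * T) ∧
          (Real.log t) ^ A < ‖L (1 / 2 + t * Complex.I)‖}).toReal ≤
        K * T / (Real.log T) ^ (4 * A - 3) := by
  obtain ⟨C, hC, hC0⟩ := exists_C0
  have hev1 : ∀ᶠ T : ℝ in Filter.atTop, 192 ≤ (Real.log T) ^ A :=
    ((tendsto_rpow_atTop hA).comp Real.tendsto_log_atTop).eventually_ge_atTop 192
  have hev2 : ∀ᶠ T : ℝ in Filter.atTop, (Real.log T) ^ (1 + 2 * A) ≤ T ^ (1 / 5 : ℝ) := by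
    have := (isLittleO_log_rpow_rpow_atTop (1 + 2 * A) (show (0:ℝ) < 1 / 5 by norm_num)).bound
      (show (0:ℝ) < 1 by norm_num)
    filter_upwards [this, Filter.eventually_ge_atTop 0] with T hT hT0
    rw [one_mul, Real.norm_of_nonneg (Real.rpow_nonneg hT0 _)] at hT
    exact (Real.le_norm_self _).trans hT
  obtain ⟨T0, hT0⟩ := Filter.eventually_atTop.mp (hev1.and hev2)
  set K1 := 4 * (32 * C ^ 2 + 768) with hK1
  set K2 := (Real.log (max T0 3)) ^ (4 * A) with hK2
  have hlog3 : 1 ≤ Real.log (max T0 3) := by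
    rw [Real.le_log_iff_exp_le (by positivity)]
    linarith [Real.exp_one_lt_d9, le_max_right T0 3]
  refine ⟨K1 + K2, fun T hT => ?_⟩
  have hTp : 0 < T := by linarith
  have hlogT : 1 ≤ Real.log T := by
    rw [Real.le_log_iff_exp_le hTp]
    linarith [Real.exp_one_lt_d9]
  have hl0 : 0 < Real.log T := by linarith
  have hmono : (Real.log T) ^ (4 * A - 3) ≤ (Real.log T) ^ (4 * A) :=
    Real.rpow_le_rpow_of_exponent_le hlogT (by linarith)
  have hpos : 0 < (Real.log T) ^ (4 * A - 3) := Real.rpow_pos_of_pos hl0 _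
  have hK1p : 0 < K1 := by positivity
  have hK2p : 0 ≤ K2 := by positivity
  rcases le_total T0 T with h | h
  · obtain ⟨h1, h2⟩ := hT0 T h
    have hm := meas_large L hL hLeq C hC hC0 T ((Real.log T) ^ A) hT h1 (by
      refine le_trans (le_of_eq ?_) h2
      rw [Real.rpow_add hl0, Real.rpow_one, ← Real.rpow_natCast, ← Real.rpow_mul hl0.le]
      congr 2; push_cast; ring)
    have hpow : ((Real.log T) ^ A) ^ 4 = (Real.log T) ^ (4 * A) := by
      rw [← Real.rpow_natCast, ← Real.rpow_mul hl0.le]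
      congr 1; push_cast; ring
    rw [hpow] at hm
    refine le_trans (ENNReal.toReal_mono ?_ (measure_mono ?_)) (hm.trans ?_)
    · refine ne_top_of_le_ne_top ?_ (measure_mono (fun t ht => ht.1 : _ ⊆ Set.Icc T (2 * T)))
      simp
    · rintro t ⟨ht, hv⟩
      refine ⟨ht, lt_of_le_of_lt ?_ hv⟩
      have := Real.log_le_log hTp ht.1
      gcongr
    · gcongr
      linarith
  · have h1 : (volume {t : ℝ | t ∈ Set.Icc T (2 * T) ∧
          (Real.log t) ^ A < ‖L (1 / 2 + t * Complex.I)‖}).toReal ≤ T := by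
      have : (volume (Set.Icc T (2 * T))).toReal = T := by
        rw [Real.volume_Icc, ENNReal.toReal_ofReal (by linarith)]; ring
      rw [← this]
      refine ENNReal.toReal_mono (by simp) (measure_mono ?_)
      rw [this]
      exact fun t ht => ht.1
    refine h1.trans ?_
    rw [le_div_iff₀ hpos, mul_comm]
    refine mul_le_mul_of_nonneg_right ?_ hTp.le
    have : (Real.log T) ^ (4 * A) ≤ K2 := by
      have := Real.log_le_log hTp (h.trans (le_max_left T0 3))
      rw [hK2]
      gcongr
    linarith

/-- Almost-Lindelöf on a set of full logarithmic density: the exceptional set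
`E_A(T) = {t ∈ [T,2T] : |L(1/2+it)| > (log t)^A}` has measure
`≪_A T/(log T)^{4A−3}`; in particular for `A > 3/4` the bound
`|L(1/2+it)| ≤ (log t)^A` holds off a set of measure `o(T)`. -/
theorem cantor_almost_lindelof
    (L : ℂ → ℂ) (hL : Differentiable ℂ L)
    (hLeq : ∀ s : ℂ, 1 < s.re → L s = cantorSeries s) :
    (∀ A : ℝ, 0 < A → ∃ K : ℝ, ∀ T : ℝ, 3 ≤ T →
      (volume {t : ℝ | t ∈ Set.Icc T (2 * T) ∧
          (Real.log t) ^ A < ‖L (1 / 2 + t * Complex.I)‖}).toReal ≤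
        K * T / (Real.log T) ^ (4 * A - 3)) ∧
    (∀ A : ℝ, 3 / 4 < A →
      Filter.Tendsto
        (fun T : ℝ =>
          (volume {t : ℝ | t ∈ Set.Icc T (2 * T) ∧
              (Real.log t) ^ A < ‖L (1 / 2 + t * Complex.I)‖}).toReal / T)
        Filter.atTop (nhds 0)) := by
  refine ⟨fun A hA => part_one L hL hLeq A hA, fun A hA => ?_⟩
  obtain ⟨K, hK⟩ := part_one L hL hLeq A (by linarith)
  have hlim : Filter.Tendsto (fun T : ℝ => K * ((Real.log T) ^ (4 * A - 3))⁻¹) Filter.atTop (nhds 0) := by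
    have := (((tendsto_rpow_atTop (show 0 < 4 * A - 3 by linarith)).comp
      Real.tendsto_log_atTop).inv_tendsto_atTop).const_mul K
    rw [mul_zero] at this
    exact this
  refine squeeze_zero' ?_ ?_ hlim
  · filter_upwards [Filter.eventually_ge_atTop 3] with T hT
    positivity
  · filter_upwards [Filter.eventually_ge_atTop 3] with T hT
    have hT0 : (0:ℝ) < T := by linarith
    rw [div_le_iff₀ hT0]
    refine (hK T hT).trans (le_of_eq ?_)
    ring
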